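/- Let K be a field and W ⊆ K^E a realization of a matroid M without loops. Suppose M = M₁ ⊕ M₂ decomposes as a direct sum with ground-set partition E = E₁ ⊔ E₂, and let W = W₁ ⊕ W₂ be the induced decomposition, where W_i := W ∩ K^{E_i} ⊆ K^{E_i} realizes M_i. Then, in K[x_e : e ∈ E], the Jacobian ideal satisfies J_W = ⟨ψ_{W₁}, ψ_{W₂}⟩ ∩ J_{W₁}·K[x] ∩ J_{W₂}·K[x], and likewise M_W = ⟨ψ_{W₁}, ψ_{W₂}⟩ ∩ M_{W₁}·K[x] ∩ M_{W₂}·K[x], where the ideals J_{W_i}, M_{W_i} ⊴ K[x_e : e ∈ E_i] are extended to K[x]. Moreover, for any realization W of a loopless matroid, the configuration hypersurface X_W is generically smooth over K: no minimal prime of K[x] over ⟨ψ_W⟩ contains J_W. -/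

import Mathlib

open scoped BigOperators

namespace Config

variable {K : Type} [Field K] {E : Type} [Fintype E] [DecidableEq E]

/-- The coordinate functional `e^∨` of `K^E` restricted to a subspace `W ⊆ K^E`. -/
noncomputable def coordFun (W : Submodule K (E → K)) (e : E) : W →ₗ[K] K :=
  (LinearMap.proj e).comp W.subtype

/-- `S ⊆ E` is independent in the matroid `M_W` realized by the configuration `W`:
the restricted coordinate functionals `(e^∨|_W)_{e ∈ S}` are linearly independent. -/
def Indep (W : Submodule K (E → K)) (S : Finset E) : Prop :=
  LinearIndependent K (fun e : S => coordFun W e)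

/-- `w` is a (linear) basis of the configuration `W ⊆ K^E`. -/
def IsBasisOf {r : ℕ} (w : Fin r → E → K) (W : Submodule K (E → K)) : Prop :=
  LinearIndependent K w ∧ Submodule.span K (Set.range w) = W

/-- The configuration (bilinear) form `Q_W` computed from the basis `w`: the symmetric
`r × r` matrix with entries `∑_{e ∈ E} x_e · w^i_e · w^j_e` over `K[x_e : e ∈ E]`. -/
noncomputable def Qform {r : ℕ} (w : Fin r → E → K) :
    Matrix (Fin r) (Fin r) (MvPolynomial E K) :=
  Matrix.of fun i j => ∑ e : E, MvPolynomial.C (w i e * w j e) * MvPolynomial.X e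

/-- The configuration polynomial `ψ_W = det Q_W` computed from the basis `w`. -/
noncomputable def psi {r : ℕ} (w : Fin r → E → K) : MvPolynomial E K :=
  (Qform w).det

/-- The ideal `M_W` generated by the submaximal, i.e. `(r−1) × (r−1)`, minors of the
configuration form `Q_W`. -/
noncomputable def minorIdeal {r : ℕ} (w : Fin r → E → K) : Ideal (MvPolynomial E K) :=
  Ideal.span {p | ∃ f g : Fin (r - 1) ↪ Fin r, p = Matrix.det ((Qform w).submatrix f g)}

/-- The Jacobian ideal `J_W = ⟨ψ_W⟩ + ⟨∂ψ_W/∂x_e : e ∈ E⟩`. -/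
noncomputable def jacIdeal {r : ℕ} (w : Fin r → E → K) : Ideal (MvPolynomial E K) :=
  Ideal.span ({psi w} ∪ Set.range fun e => MvPolynomial.pderiv e (psi w))

/-- The subspace of vectors of `K^E` supported on the subset `F`. -/
noncomputable def suppOn (F : Finset E) : Submodule K (E → K) :=
  LinearMap.ker (LinearMap.funLeft K K (fun e : {x : E // x ∉ F} => (e : E)))

section Aux

set_option linter.unusedSectionVars false

open MvPolynomial Matrix

/-! ### Ideal-theoretic lemmas -/

/-- A nonzero polynomial over `K` stays a nonzerodivisor over a `K`-algebra `A`. -/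
lemma map_regular {A : Type} [CommRing A] [Algebra K A] {ψ : MvPolynomial E K} (hψ : ψ ≠ 0)
    {f : MvPolynomial E A} (hf : f * MvPolynomial.map (algebraMap K A) ψ = 0) : f = 0 := by
  classical
  ext m
  rw [coeff_zero, ← Module.forall_dual_apply_eq_zero_iff K]
  intro l
  set g : MvPolynomial E K := ∑ a ∈ f.support, monomial a (l (coeff a f)) with hg
  have hgc : ∀ a, coeff a g = l (coeff a f) := by
    intro a
    simp only [hg, coeff_sum, coeff_monomial, Finset.sum_ite_eq', mem_support_iff]
    split_ifs with h
    · rfl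
    · rw [not_not.mp h, map_zero]
  have h0 : g * ψ = 0 := by
    ext n
    have h1 := congrArg (fun q => l (coeff n q)) hf
    simp only [coeff_mul, coeff_map, coeff_zero, map_zero, map_sum] at h1
    rw [coeff_mul, coeff_zero, ← h1]
    refine Finset.sum_congr rfl fun x _ => ?_
    rw [hgc, mul_comm (coeff x.1 f), ← Algebra.smul_def, map_smul, smul_eq_mul, mul_comm]
  have h2 : g = 0 := (mul_eq_zero.mp h0).resolve_right hψ
  rw [← hgc, h2, coeff_zero]

/-- A nonzero polynomial in variables from `t` is a nonzerodivisor modulo an ideal generated by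
polynomials in variables from a disjoint set `s`. -/
lemma mem_of_mul_mem {s t : Set E} (hst : Disjoint s t) {G : Set (MvPolynomial E K)}
    (hG : ∀ g ∈ G, g ∈ supported K s) {ψ : MvPolynomial E K} (hψ0 : ψ ≠ 0)
    (hψ : ψ ∈ supported K t) {b : MvPolynomial E K} (hb : b * ψ ∈ Ideal.span G) :
    b ∈ Ideal.span G := by
  classical
  let J := Ideal.span G
  let A := MvPolynomial E K ⧸ J
  let θ : MvPolynomial E K →+* MvPolynomial E A :=
    eval₂Hom (MvPolynomial.C.comp (algebraMap K A))
      (fun e => if e ∈ s then MvPolynomial.C (Ideal.Quotient.mk J (X e)) else X e)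
  have hθJ : ∀ g ∈ supported K s, θ g = MvPolynomial.C (Ideal.Quotient.mk J g) := by
    intro g hg
    refine hom_congr_vars (f₁ := θ) (f₂ := MvPolynomial.C.comp (Ideal.Quotient.mk J)) ?_ ?_ rfl
    · ext x : 1
      simp [θ]
      rfl
    · intro i hi _
      have : i ∈ s := mem_supported.mp hg hi
      simp [θ, this]
  have hθψ : θ ψ = MvPolynomial.map (algebraMap K A) ψ := by
    refine hom_congr_vars (f₁ := θ) (f₂ := MvPolynomial.map (algebraMap K A)) ?_ ?_ rfl
    · ext x : 1
      simp [θ]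
    · intro i hi _
      have : i ∉ s := fun h => Set.disjoint_left.mp hst h (mem_supported.mp hψ hi)
      simp [θ, this]
  have hker : J ≤ RingHom.ker θ := by
    refine Ideal.span_le.mpr fun g hg => ?_
    rw [SetLike.mem_coe, RingHom.mem_ker, hθJ g (hG g hg),
      Ideal.Quotient.eq_zero_iff_mem.mpr (Ideal.subset_span hg), map_zero]
  have h1 : θ b * MvPolynomial.map (algebraMap K A) ψ = 0 := by
    rw [← hθψ, ← map_mul]
    exact hker hb
  have h2 : θ b = 0 := map_regular hψ0 h1
  let ev : MvPolynomial E A →+* A := eval₂Hom (RingHom.id A) (fun e => Ideal.Quotient.mk J (X e))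
  have h3 : ev.comp θ = Ideal.Quotient.mk J := by
    apply MvPolynomial.ringHom_ext
    · intro x
      simp [ev, θ]
      rfl
    · intro i
      by_cases hi : i ∈ s <;> simp [ev, θ, hi]
  have h4 : Ideal.Quotient.mk J b = 0 := by
    rw [← h3, RingHom.comp_apply, h2, map_zero]
  exact Ideal.Quotient.eq_zero_iff_mem.mp h4

lemma ideal_decomp {R : Type} [CommRing R] {a b : R} {I J : Ideal R} (ha : a ∈ I) (hb : b ∈ J)
    (hI : ∀ x, x * b ∈ I → x ∈ I) (hJ : ∀ x, x * a ∈ J → x ∈ J) :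
    Ideal.span {b} * I ⊔ Ideal.span {a} * J = Ideal.span {a, b} ⊓ I ⊓ J := by
  apply le_antisymm
  · refine sup_le (Ideal.span_singleton_mul_le_iff.mpr ?_) (Ideal.span_singleton_mul_le_iff.mpr ?_)
    · intro z hz
      exact ⟨⟨Ideal.mul_mem_right _ _ (Ideal.subset_span (by simp)), I.mul_mem_left _ hz⟩,
        J.mul_mem_right _ hb⟩
    · intro z hz
      exact ⟨⟨Ideal.mul_mem_right _ _ (Ideal.subset_span (by simp)), I.mul_mem_right _ ha⟩,
        J.mul_mem_left _ hz⟩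
  · rintro x ⟨⟨h, hxI⟩, hxJ⟩
    obtain ⟨c, d, rfl⟩ := Ideal.mem_span_pair.mp h
    have hd : d ∈ I := hI d ((I.add_mem_iff_right (I.mul_mem_left c ha)).mp hxI)
    have hc : c ∈ J := hJ c ((J.add_mem_iff_left (J.mul_mem_left d hb)).mp hxJ)
    rw [add_comm]
    refine Submodule.add_mem_sup ?_ ?_
    · exact Ideal.mem_span_singleton_mul.mpr ⟨d, hd, mul_comm _ _⟩
    · exact Ideal.mem_span_singleton_mul.mpr ⟨c, hc, mul_comm _ _⟩

/-! ### Supported polynomials -/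

lemma pderiv_supported {s : Set E} {p : MvPolynomial E K} (hp : p ∈ supported K s) (e : E) :
    pderiv e p ∈ supported K s := by
  rw [supported_eq_adjoin_X] at hp ⊢
  induction hp using Algebra.adjoin_induction with
  | mem x hx =>
    obtain ⟨i, _, rfl⟩ := hx
    rw [pderiv_X]
    by_cases h : i = e
    · subst h; simp
    · simp [h]
  | algebraMap r =>
    rw [algebraMap_eq, pderiv_C]; exact zero_mem _
  | add x y hx hy h1 h2 => rw [map_add]; exact add_mem h1 h2
  | mul x y hx hy h1 h2 =>
    rw [Derivation.leibniz]
    exact add_mem (by rw [smul_eq_mul]; exact mul_mem hx h2) (by rw [smul_eq_mul]; exact mul_mem hy h1)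

lemma det_supported {n : Type} [Fintype n] [DecidableEq n] {S : Subalgebra K (MvPolynomial E K)}
    {A : Matrix n n (MvPolynomial E K)} (hA : ∀ i j, A i j ∈ S) : A.det ∈ S := by
  rw [det_apply]
  refine sum_mem fun σ _ => ?_
  rw [Units.smul_def]
  exact zsmul_mem (prod_mem fun i _ => hA _ _) _

/-! ### Generic smoothness -/

lemma dvd_supported {q B : MvPolynomial E K} {e : E} (he : e ∈ q.vars)
    (hB : B ∈ supported K ({e}ᶜ : Set E)) (h : q ∣ B) : B = 0 := by
  classical
  by_contra h0
  obtain ⟨c, rfl⟩ := h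
  have hq : q ≠ 0 := left_ne_zero_of_mul h0
  have hc : c ≠ 0 := right_ne_zero_of_mul h0
  have h1 : degreeOf e (q * c) = 0 := by
    by_contra h2
    have : e ∈ (q * c).vars := by
      rw [vars_def, Multiset.mem_toFinset, ← Multiset.count_ne_zero, ← degreeOf_def]; exact h2
    have := mem_supported.mp hB this
    simp at this
  rw [degreeOf_mul_eq hq hc] at h1
  rw [vars_def, Multiset.mem_toFinset, ← Multiset.count_ne_zero, ← degreeOf_def] at he
  omega

lemma smooth_aux {ψ : MvPolynomial E K} (hψ : ψ ≠ 0)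
    (hlin : ∀ e, ∃ A ∈ supported K ({e}ᶜ : Set E), ∃ B ∈ supported K ({e}ᶜ : Set E),
      ψ = A + X e * B)
    (p : Ideal (MvPolynomial E K)) (hp : p ∈ (Ideal.span {ψ}).minimalPrimes)
    (hle : Ideal.span ({ψ} ∪ Set.range fun e => pderiv e ψ) ≤ p) : False := by
  have hpp : p.IsPrime := hp.1.1
  have hψp : ψ ∈ p := hp.1.2 (Ideal.mem_span_singleton_self ψ)
  obtain ⟨f, hf, hfa⟩ := UniqueFactorizationMonoid.exists_prime_factors ψ hψ
  have hfp : f.prod ∈ p := by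
    obtain ⟨u, hu⟩ := hfa.symm
    rw [← hu]; exact p.mul_mem_right _ hψp
  obtain ⟨q, hqf, hqp⟩ := (hpp.multiset_prod_mem_iff_exists_mem f).mp hfp
  have hq := hf q hqf
  have hqψ : q ∣ ψ := (Multiset.dvd_prod hqf).trans hfa.dvd
  have hple : p ≤ Ideal.span {q} := by
    refine hp.2 ⟨(Ideal.span_singleton_prime hq.ne_zero).mpr hq, ?_⟩
      ((Ideal.span_singleton_le_iff_mem _).mpr hqp)
    rw [Ideal.span_singleton_le_span_singleton]
    exact hqψ
  have hvars : q.vars.Nonempty := by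
    by_contra h
    rw [Finset.not_nonempty_iff_eq_empty, vars_eq_empty_iff_eq_C] at h
    refine hq.not_isUnit ?_
    rw [h]
    refine IsUnit.map MvPolynomial.C (isUnit_iff_ne_zero.mpr fun h0 => hq.ne_zero ?_)
    rw [h, h0, map_zero]
  obtain ⟨e, he⟩ := hvars
  obtain ⟨A, hA, B, hB, hAB⟩ := hlin e
  have hz : ∀ C ∈ supported K ({e}ᶜ : Set E), pderiv e C = 0 := fun C hC =>
    pderiv_eq_zero_of_notMem_vars fun h => by simpa using mem_supported.mp hC h
  have hd : pderiv e ψ = B := by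
    rw [hAB, map_add, Derivation.leibniz, hz A hA, hz B hB, pderiv_X_self]
    simp
  have hqB : q ∣ B := by
    rw [← hd, ← Ideal.mem_span_singleton]
    exact hple (hle (Ideal.subset_span (Or.inr ⟨e, rfl⟩)))
  have hB0 : B = 0 := dvd_supported he hB hqB
  rw [hB0, mul_zero, add_zero] at hAB
  rw [hAB] at hqψ hψ
  exact hψ (dvd_supported he hA hqψ)

/-! ### Configuration forms over arbitrary index types -/

noncomputable def QG {ι : Type} (w : ι → E → K) : Matrix ι ι (MvPolynomial E K) :=
  Matrix.of fun i j => ∑ e : E, MvPolynomial.C (w i e * w j e) * MvPolynomial.X e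

lemma QG_supported {ι : Type} {w : ι → E → K} {s : Set E} (h : ∀ i, ∀ e ∉ s, w i e = 0) (i j : ι) :
    QG w i j ∈ supported K s := by
  refine sum_mem fun e _ => ?_
  by_cases he : e ∈ s
  · exact mul_mem (Subalgebra.algebraMap_mem _ _) (X_mem_supported.mpr he)
  · rw [h i e he, zero_mul, map_zero, zero_mul]; exact zero_mem _

lemma det_rank_one {ι : Type} [Fintype ι] [DecidableEq ι] {s : Subalgebra K (MvPolynomial E K)}
    {Q : Matrix ι ι (MvPolynomial E K)} {u : ι → MvPolynomial E K} (x : MvPolynomial E K)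
    (hQ : ∀ i j, Q i j ∈ s) (hu : ∀ i, u i ∈ s) :
    ∃ B ∈ s, (Matrix.of fun i j => Q i j + x * (u i * u j)).det = Q.det + x * B := by
  classical
  let U : Matrix ι Unit (MvPolynomial E K) := Matrix.of fun i _ => u i
  let V : Matrix Unit ι (MvPolynomial E K) := Matrix.of fun _ i => - u i
  refine ⟨(fromBlocks Q U V 0).det, det_supported ?_, ?_⟩
  · rintro (i | i) (j | j)
    · exact hQ i j
    · exact hu i
    · exact neg_mem (hu j)
    · exact zero_mem _
  · have h1 : (Matrix.of fun i j => Q i j + x * (u i * u j)) = Q - U * (x • V) := by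
      ext1 i j
      simp [U, V, Matrix.mul_apply]
      ring
    have h2 : fromBlocks Q U (x • V) (1 : Matrix Unit Unit _) =
        (fromBlocks Q U V 0).updateRow (Sum.inr ()) (x • (Sum.elim (V ()) 0) + Pi.single (Sum.inr ()) 1) := by
      ext1 i j
      rcases i with i | i <;> rcases j with j | j <;> simp [Matrix.updateRow_apply]
    rw [h1, ← det_fromBlocks_one₂₂, h2, det_updateRow_add, det_updateRow_smul, add_comm]
    congr 1
    · have : (fromBlocks Q U V 0).updateRow (Sum.inr ()) (Pi.single (Sum.inr ()) 1) =
          fromBlocks Q U 0 1 := by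
        ext1 i j
        rcases i with i | i <;> rcases j with j | j <;> simp [Matrix.updateRow_apply]
      rw [this, det_fromBlocks_zero₂₁, det_one, mul_one]
    · congr 2
      ext1 i j
      rcases i with i | i <;> rcases j with j | j <;> simp [Matrix.updateRow_apply]

lemma det_QG_linear {ι : Type} [Fintype ι] [DecidableEq ι] (w : ι → E → K) (e : E) :
    ∃ A ∈ supported K ({e}ᶜ : Set E), ∃ B ∈ supported K ({e}ᶜ : Set E),
      (QG w).det = A + X e * B := by
  let Q : Matrix ι ι (MvPolynomial E K) := Matrix.of fun i j =>
    ∑ e' ∈ Finset.univ.erase e, MvPolynomial.C (w i e' * w j e') * MvPolynomial.X e'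
  have hQ : ∀ i j, Q i j ∈ supported K ({e}ᶜ : Set E) := by
    intro i j
    refine sum_mem fun e' he' => ?_
    exact mul_mem (Subalgebra.algebraMap_mem _ _)
      (X_mem_supported.mpr (by simpa using (Finset.mem_erase.mp he').1))
  obtain ⟨B, hB, h⟩ := det_rank_one (u := fun i => MvPolynomial.C (w i e)) (X e) hQ
    (fun i => Subalgebra.algebraMap_mem _ _)
  refine ⟨Q.det, det_supported hQ, B, hB, ?_⟩
  rw [← h]
  congr 1
  ext1 i j
  simp only [QG, Q, of_apply]
  rw [← Finset.sum_erase_add _ _ (Finset.mem_univ e), map_mul, mul_comm (X e)]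

lemma exists_minor {ι : Type} [Fintype ι] [DecidableEq ι] {w : ι → E → K}
    (hw : LinearIndependent K w) :
    ∃ f : ι → E, Function.Injective f ∧ (Matrix.of fun i j => w i (f j)).det ≠ 0 := by
  classical
  let M : Matrix ι E K := Matrix.of w
  have hM : LinearIndependent K M.row := hw
  have hr := hM.rank_matrix
  rw [rank_eq_finrank_span_cols] at hr
  obtain ⟨κ, a, ha, hspan, hli⟩ := exists_linearIndependent' K M.col
  have htop : Submodule.span K (Set.range (M.col ∘ a)) = ⊤ := by
    rw [hspan]
    apply Submodule.eq_top_of_finrank_eq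
    rw [hr, Module.finrank_fintype_fun_eq_card]
  let b := Module.Basis.mk hli htop.ge
  let ε : ι ≃ κ := (Pi.basisFun K ι).indexEquiv b
  refine ⟨a ∘ ε, ha.comp ε.injective, ?_⟩
  have h1 : LinearIndependent K ((Matrix.of fun i j => w i ((a ∘ ε) j))ᵀ).row :=
    hli.comp ε ε.injective
  rw [linearIndependent_rows_iff_isUnit, isUnit_iff_isUnit_det, det_transpose] at h1
  exact h1.ne_zero

lemma det_QG_ne_zero {ι : Type} [Fintype ι] [DecidableEq ι] {w : ι → E → K}
    (hw : LinearIndependent K w) : (QG w).det ≠ 0 := by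
  classical
  obtain ⟨f, hf, hdet⟩ := exists_minor hw
  intro h0
  let ev : MvPolynomial E K →+* K := eval fun e => if e ∈ Set.range f then 1 else 0
  have h1 : ev (QG w).det = 0 := by rw [h0, map_zero]
  rw [RingHom.map_det] at h1
  set N : Matrix ι ι K := Matrix.of fun i j => w i (f j) with hN
  have h2 : ev.mapMatrix (QG w) = N * Nᵀ := by
    ext1 i j
    simp only [RingHom.mapMatrix_apply, Matrix.map_apply, QG, of_apply, map_sum, map_mul, ev,
      eval_C, eval_X, Matrix.mul_apply, Matrix.transpose_apply, hN, mul_ite, mul_one, mul_zero]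
    rw [← Finset.sum_filter]
    have : Finset.univ.filter (fun e => e ∈ Set.range f) = Finset.univ.image f := by
      ext e; simp
    rw [this, Finset.sum_image fun _ _ _ _ h => hf h]
  rw [h2, det_mul, det_transpose] at h1
  exact hdet (mul_self_eq_zero.mp h1)

lemma QG_eq {ι : Type} (w : ι → E → K) :
    QG w = (Matrix.of w : Matrix ι E K).map (MvPolynomial.C (σ := E)) *
      (diagonal (fun e : E => X e) : Matrix E E (MvPolynomial E K)) *
      ((Matrix.of w : Matrix ι E K).map (MvPolynomial.C (σ := E)))ᵀ := by
  ext1 i j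
  rw [Matrix.mul_apply]
  simp only [QG, of_apply, mul_diagonal, Matrix.map_apply, transpose_apply, map_mul]
  refine Finset.sum_congr rfl fun e _ => ?_
  ring

lemma basis_change {ι κ : Type} [Fintype ι] [DecidableEq ι] [Fintype κ] [DecidableEq κ]
    {u : ι → E → K} {v : κ → E → K} (hu : LinearIndependent K u) (hv : LinearIndependent K v)
    (h : Submodule.span K (Set.range u) = Submodule.span K (Set.range v)) :
    ∃ (ε : ι ≃ κ) (P P' : Matrix ι ι K), P * P' = 1 ∧
      QG u = P.map MvPolynomial.C * (QG v).submatrix ε ε * (P.map MvPolynomial.C)ᵀ := by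
  let bu := Module.Basis.span hu
  let bv := (Module.Basis.span hv).map (LinearEquiv.ofEq _ _ h.symm)
  let ε : ι ≃ κ := bu.indexEquiv bv
  let b := bv.reindex ε.symm
  refine ⟨ε, (b.toMatrix bu)ᵀ, (bu.toMatrix b)ᵀ, ?_, ?_⟩
  · rw [← transpose_mul, Module.Basis.toMatrix_mul_toMatrix_flip, transpose_one]
  · have hb : ∀ i, ((b i : Submodule.span K (Set.range u)) : E → K) = v (ε i) := by
      intro i
      simp [b, bv, Module.Basis.span_apply]
    have hcomb : ∀ i e, u i e = ∑ k, b.toMatrix bu k i * v (ε k) e := by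
      intro i e
      have h1 := congrArg (fun z : Submodule.span K (Set.range u) => (z : E → K) e)
        (b.sum_toMatrix_smul_self bu i)
      simp only [Submodule.coe_sum, Finset.sum_apply, Submodule.coe_smul, Pi.smul_apply, hb,
        smul_eq_mul] at h1
      rw [h1]
      simp [bu, Module.Basis.span_apply]
    have hmat : (Matrix.of u : Matrix ι E K) =
        (b.toMatrix bu)ᵀ * (Matrix.of (v ∘ ε) : Matrix ι E K) := by
      ext1 i e
      simp only [of_apply, Matrix.mul_apply, transpose_apply, Function.comp_apply]
      exact hcomb i e
    have h2 : (QG v).submatrix ε ε = QG (v ∘ ε) := rfl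
    rw [h2, QG_eq, QG_eq, hmat, Matrix.map_mul, transpose_mul]
    simp only [Matrix.mul_assoc]

/-- The ideal generated by the entries of the adjugate. -/
def adjI {R : Type} [CommRing R] {n : Type} [Fintype n] [DecidableEq n] (A : Matrix n n R) :
    Ideal R :=
  Ideal.span (Set.range fun p : n × n => A.adjugate p.1 p.2)

lemma adj_mem {R : Type} [CommRing R] {n : Type} [Fintype n] [DecidableEq n] (A : Matrix n n R)
    (i j : n) : A.adjugate i j ∈ adjI A := Ideal.subset_span ⟨(i, j), rfl⟩

lemma adjI_le {R : Type} [CommRing R] {n : Type} [Fintype n] [DecidableEq n] {A : Matrix n n R}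
    {I : Ideal R} (h : ∀ i j, A.adjugate i j ∈ I) : adjI A ≤ I := by
  refine Ideal.span_le.mpr ?_
  rintro _ ⟨p, rfl⟩
  exact h _ _

lemma adjI_mul_le {R : Type} [CommRing R] {n : Type} [Fintype n] [DecidableEq n]
    (P A Q : Matrix n n R) : adjI (P * A * Q) ≤ adjI A := by
  refine adjI_le fun i j => ?_
  rw [adjugate_mul_distrib, adjugate_mul_distrib, Matrix.mul_apply]
  refine Ideal.sum_mem _ fun k _ => Ideal.mul_mem_left _ _ ?_
  rw [Matrix.mul_apply]
  exact Ideal.sum_mem _ fun l _ => Ideal.mul_mem_right _ _ (adj_mem _ _ _)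

lemma adjI_submatrix {R : Type} [CommRing R] {n m : Type} [Fintype n] [DecidableEq n] [Fintype m]
    [DecidableEq m] (ε : n ≃ m) (A : Matrix m m R) : adjI (A.submatrix ε ε) = adjI A := by
  apply le_antisymm
  · refine adjI_le fun i j => ?_
    rw [adjugate_submatrix_equiv_self]
    exact adj_mem _ _ _
  · refine adjI_le fun i j => ?_
    have h := adj_mem (A.submatrix ε ε) (ε.symm i) (ε.symm j)
    rw [adjugate_submatrix_equiv_self] at h
    simpa using h

lemma adjI_inv {ι κ : Type} [Fintype ι] [DecidableEq ι] [Fintype κ] [DecidableEq κ]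
    {u : ι → E → K} {v : κ → E → K} (hu : LinearIndependent K u) (hv : LinearIndependent K v)
    (h : Submodule.span K (Set.range u) = Submodule.span K (Set.range v)) :
    adjI (QG u) = adjI (QG v) := by
  have key : ∀ {ι κ : Type} [Fintype ι] [DecidableEq ι] [Fintype κ] [DecidableEq κ]
      {u : ι → E → K} {v : κ → E → K}, LinearIndependent K u → LinearIndependent K v →
      Submodule.span K (Set.range u) = Submodule.span K (Set.range v) →
      adjI (QG u) ≤ adjI (QG v) := by
    intro ι κ _ _ _ _ u v hu hv h
    obtain ⟨ε, P, P', _, hQ⟩ := basis_change hu hv h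
    rw [hQ, ← adjI_submatrix ε (QG v)]
    exact adjI_mul_le _ _ _
  exact le_antisymm (key hu hv h) (key hv hu h.symm)

lemma det_inv {ι κ : Type} [Fintype ι] [DecidableEq ι] [Fintype κ] [DecidableEq κ]
    {u : ι → E → K} {v : κ → E → K} (hu : LinearIndependent K u) (hv : LinearIndependent K v)
    (h : Submodule.span K (Set.range u) = Submodule.span K (Set.range v)) :
    ∃ c : K, c ≠ 0 ∧ (QG u).det = MvPolynomial.C c * (QG v).det := by
  obtain ⟨ε, P, P', hP, hQ⟩ := basis_change hu hv h
  have hd : P.det ≠ 0 := by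
    intro h0
    have := congrArg det hP
    rw [det_mul, h0, zero_mul, det_one] at this
    exact zero_ne_one this
  refine ⟨P.det * P.det, mul_ne_zero hd hd, ?_⟩
  have hC : (P.map (MvPolynomial.C (σ := E))).det = MvPolynomial.C P.det :=
    (RingHom.map_det MvPolynomial.C P).symm
  rw [hQ, det_mul, det_mul, det_transpose, det_submatrix_equiv_self, hC, map_mul]
  ring

lemma embedding_succ {n : ℕ} (f : Fin n ↪ Fin (n + 1)) :
    ∃ (i : Fin (n + 1)) (σ : Equiv.Perm (Fin n)), ∀ k, f k = i.succAbove (σ k) := by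
  have h : ¬ Function.Surjective f := fun h => by
    have := Fintype.card_le_of_surjective f h
    simp at this
  rw [Function.Surjective] at h
  push Not at h
  obtain ⟨i, hi⟩ := h
  choose σ hσ using fun k => Fin.exists_succAbove_eq (hi k)
  have hinj : Function.Injective σ := fun a b hab => f.injective (by rw [← hσ, ← hσ, hab])
  exact ⟨i, Equiv.ofBijective σ (Finite.injective_iff_bijective.mp hinj), fun k => (hσ k).symm⟩

lemma minorIdeal_eq {r : ℕ} (hr : r ≠ 0) (w : Fin r → E → K) : minorIdeal w = adjI (QG w) := by
  obtain ⟨n, rfl⟩ := Nat.exists_eq_succ_of_ne_zero hr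
  apply le_antisymm
  · refine Ideal.span_le.mpr ?_
    rintro _ ⟨f, g, rfl⟩
    change Fin n ↪ Fin (n + 1) at f g
    obtain ⟨i, σ, hσ⟩ := embedding_succ f
    obtain ⟨j, τ, hτ⟩ := embedding_succ g
    have h1 : (Qform w).submatrix f g =
        (((Qform w).submatrix i.succAbove j.succAbove).submatrix id τ).submatrix σ id := by
      ext1 a b
      simp only [submatrix_apply, id, hσ, hτ]
    have h2 := adj_mem (QG w) j i
    rw [adjugate_fin_succ_eq_det_submatrix] at h2
    have h3 : ((QG w).submatrix i.succAbove j.succAbove).det ∈ adjI (QG w) := by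
      have h4 := Ideal.mul_mem_left (adjI (QG w)) ((-1) ^ (i + j : ℕ)) h2
      rwa [← mul_assoc, ← mul_pow, neg_one_mul, neg_neg, one_pow, one_mul] at h4
    rw [SetLike.mem_coe]
    change ((Qform w).submatrix f g).det ∈ _
    rw [h1, det_permute, det_permute']
    exact Ideal.mul_mem_left _ _ (Ideal.mul_mem_left _ _ h3)
  · refine adjI_le fun i j => ?_
    rw [adjugate_fin_succ_eq_det_submatrix]
    exact Ideal.mul_mem_left _ _ (Ideal.subset_span
      ⟨Fin.succAboveEmb j, Fin.succAboveEmb i, rfl⟩)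

lemma minorIdeal_zero (w : Fin 0 → E → K) : minorIdeal w = ⊤ := by
  rw [Ideal.eq_top_iff_one]
  refine Ideal.subset_span ⟨Function.Embedding.refl _, Function.Embedding.refl _, ?_⟩
  exact (det_isEmpty (R := MvPolynomial E K) (n := Fin 0)).symm

lemma det_mem_adjI {ι : Type} [Fintype ι] [DecidableEq ι] {R : Type} [CommRing R]
    (A : Matrix ι ι R) (i : ι) : A.det ∈ adjI A := by
  rw [det_eq_sum_mul_adjugate_row A i]
  exact Ideal.sum_mem _ fun k _ => Ideal.mul_mem_left _ _ (adj_mem _ _ _)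

lemma minorIdeal_inv {r r' : ℕ} {u : Fin r → E → K} {v : Fin r' → E → K}
    (hu : LinearIndependent K u) (hv : LinearIndependent K v)
    (h : Submodule.span K (Set.range u) = Submodule.span K (Set.range v)) :
    minorIdeal u = minorIdeal v := by
  obtain ⟨ε, _⟩ := basis_change hu hv h
  obtain rfl : r = r' := by simpa using Fintype.card_congr ε
  rcases Nat.eq_zero_or_pos r with rfl | hr
  · rw [minorIdeal_zero, minorIdeal_zero]
  · rw [minorIdeal_eq hr.ne', minorIdeal_eq hr.ne', adjI_inv hu hv h]

lemma adjugate_block {ι κ : Type} [Fintype ι] [DecidableEq ι] [Fintype κ] [DecidableEq κ]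
    {R : Type} [CommRing R] [IsDomain R] (A : Matrix ι ι R) (D : Matrix κ κ R)
    (hA : A.det ≠ 0) (hD : D.det ≠ 0) :
    (fromBlocks A 0 0 D).adjugate = fromBlocks (D.det • A.adjugate) 0 0 (A.det • D.adjugate) := by
  have hdet : (fromBlocks A 0 0 D).det = A.det * D.det := det_fromBlocks_zero₂₁ _ _ _
  have hreg : IsRegular (fromBlocks A 0 0 D) := isRegular_of_isLeftRegular_det
    (IsLeftCancelMulZero.mul_left_cancel_of_ne_zero (by rw [hdet]; exact mul_ne_zero hA hD))
  apply hreg.left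
  change fromBlocks A 0 0 D * _ = fromBlocks A 0 0 D * _
  rw [mul_adjugate, hdet, fromBlocks_multiply]
  simp only [Matrix.mul_smul, mul_adjugate, Matrix.mul_zero, Matrix.zero_mul, add_zero, zero_add,
    smul_smul]
  rw [← fromBlocks_one, fromBlocks_smul, mul_comm D.det]
  simp

lemma adjI_block {ι κ : Type} [Fintype ι] [DecidableEq ι] [Fintype κ] [DecidableEq κ]
    {R : Type} [CommRing R] [IsDomain R] (A : Matrix ι ι R) (D : Matrix κ κ R)
    (hA : A.det ≠ 0) (hD : D.det ≠ 0) :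
    adjI (fromBlocks A 0 0 D) = Ideal.span {D.det} * adjI A ⊔ Ideal.span {A.det} * adjI D := by
  have hadj := adjugate_block A D hA hD
  apply le_antisymm
  · refine adjI_le fun i j => ?_
    rw [hadj]
    rcases i with i | i <;> rcases j with j | j
    · exact Ideal.mem_sup_left (Ideal.mul_mem_mul (Ideal.mem_span_singleton_self _) (adj_mem _ _ _))
    · exact zero_mem _
    · exact zero_mem _
    · exact Ideal.mem_sup_right (Ideal.mul_mem_mul (Ideal.mem_span_singleton_self _) (adj_mem _ _ _))
  · refine sup_le ?_ ?_
    · rw [adjI, Ideal.span_mul_span', Ideal.span_le]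
      rintro _ ⟨_, rfl, _, ⟨⟨i, j⟩, rfl⟩, rfl⟩
      have h := adj_mem (fromBlocks A 0 0 D) (Sum.inl i) (Sum.inl j)
      rw [hadj] at h
      exact h
    · rw [adjI, Ideal.span_mul_span', Ideal.span_le]
      rintro _ ⟨_, rfl, _, ⟨⟨i, j⟩, rfl⟩, rfl⟩
      have h := adj_mem (fromBlocks A 0 0 D) (Sum.inr i) (Sum.inr j)
      rw [hadj] at h
      exact h

lemma QG_block {ι κ : Type} [Fintype ι] [DecidableEq ι] [Fintype κ] [DecidableEq κ]
    {u : ι → E → K} {v : κ → E → K} (h : ∀ i j e, u i e * v j e = 0) :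
    QG (Sum.elim u v) = fromBlocks (QG u) 0 0 (QG v) := by
  ext1 i j
  rcases i with i | i <;> rcases j with j | j
  · rfl
  · simp [QG, h, -MvPolynomial.C_mul, -map_mul]
  · simp [QG, -MvPolynomial.C_mul, -map_mul, fun i j e => (mul_comm (v j e) (u i e)).trans (h i j e)]
  · rfl

lemma jac_block {s : Set E} {ψ ψ₁ ψ₂ : MvPolynomial E K} {c : K} (hc : c ≠ 0)
    (hψ : ψ = MvPolynomial.C c * (ψ₁ * ψ₂)) (h₁ : ψ₁ ∈ supported K s) (h₂ : ψ₂ ∈ supported K sᶜ) :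
    Ideal.span ({ψ} ∪ Set.range fun e => pderiv e ψ) =
      Ideal.span {ψ₂} * Ideal.span ({ψ₁} ∪ Set.range fun e => pderiv e ψ₁) ⊔
      Ideal.span {ψ₁} * Ideal.span ({ψ₂} ∪ Set.range fun e => pderiv e ψ₂) := by
  have z₁ : ∀ e ∉ s, pderiv e ψ₁ = 0 := fun e he =>
    pderiv_eq_zero_of_notMem_vars fun h => he (mem_supported.mp h₁ h)
  have z₂ : ∀ e ∈ s, pderiv e ψ₂ = 0 := fun e he =>
    pderiv_eq_zero_of_notMem_vars fun h => mem_supported.mp h₂ h he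
  have hd : ∀ e, pderiv e ψ = MvPolynomial.C c * (ψ₂ * pderiv e ψ₁ + ψ₁ * pderiv e ψ₂) := by
    intro e
    rw [hψ, pderiv_C_mul, Derivation.leibniz, smul_eq_mul, smul_eq_mul, add_comm]
  have hcc : ∀ x : MvPolynomial E K, x = MvPolynomial.C c⁻¹ * (MvPolynomial.C c * x) := by
    intro x
    rw [← mul_assoc, ← map_mul, inv_mul_cancel₀ hc, map_one, one_mul]
  have m1 : ∀ x ∈ ({ψ₁} ∪ Set.range fun e => pderiv e ψ₁ : Set (MvPolynomial E K)),
      ψ₂ * x ∈ Ideal.span {ψ₂} * Ideal.span ({ψ₁} ∪ Set.range fun e => pderiv e ψ₁) := fun x hx =>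
    Ideal.mul_mem_mul (Ideal.mem_span_singleton_self _) (Ideal.subset_span hx)
  have m2 : ∀ x ∈ ({ψ₂} ∪ Set.range fun e => pderiv e ψ₂ : Set (MvPolynomial E K)),
      ψ₁ * x ∈ Ideal.span {ψ₁} * Ideal.span ({ψ₂} ∪ Set.range fun e => pderiv e ψ₂) := fun x hx =>
    Ideal.mul_mem_mul (Ideal.mem_span_singleton_self _) (Ideal.subset_span hx)
  have hψm : MvPolynomial.C c * (ψ₁ * ψ₂) ∈ Ideal.span ({ψ} ∪ Set.range fun e => pderiv e ψ) := by
    rw [← hψ]; exact Ideal.subset_span (Or.inl rfl)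
  have hdm : ∀ e, MvPolynomial.C c * (ψ₂ * pderiv e ψ₁ + ψ₁ * pderiv e ψ₂) ∈
      Ideal.span ({ψ} ∪ Set.range fun e => pderiv e ψ) := by
    intro e; rw [← hd]; exact Ideal.subset_span (Or.inr ⟨e, rfl⟩)
  apply le_antisymm
  · refine Ideal.span_le.mpr ?_
    rintro _ (rfl | ⟨e, rfl⟩)
    · rw [hψ, mul_comm ψ₁]
      exact Ideal.mul_mem_left _ _ (Ideal.mem_sup_left (m1 _ (Or.inl rfl)))
    · change pderiv e ψ ∈ _
      rw [hd]
      exact Ideal.mul_mem_left _ _ (Submodule.add_mem_sup (m1 _ (Or.inr ⟨e, rfl⟩))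
        (m2 _ (Or.inr ⟨e, rfl⟩)))
  · refine sup_le ?_ ?_
    · rw [Ideal.span_mul_span', Ideal.span_le]
      rintro _ ⟨y, hy, z, hz, rfl⟩
      rw [Set.mem_singleton_iff] at hy
      rw [hy]
      rcases hz with hz | ⟨e, rfl⟩
      · rw [Set.mem_singleton_iff.mp hz]
        change ψ₂ * ψ₁ ∈ _
        rw [hcc (ψ₂ * ψ₁), mul_comm ψ₂]
        exact Ideal.mul_mem_left _ _ hψm
      · change ψ₂ * pderiv e ψ₁ ∈ _
        by_cases he : e ∈ s
        · have := hdm e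
          rw [z₂ e he, mul_zero, add_zero] at this
          rw [hcc (ψ₂ * _)]
          exact Ideal.mul_mem_left _ _ this
        · rw [z₁ e he, mul_zero]; exact zero_mem _
    · rw [Ideal.span_mul_span', Ideal.span_le]
      rintro _ ⟨y, hy, z, hz, rfl⟩
      rw [Set.mem_singleton_iff] at hy
      rw [hy]
      rcases hz with hz | ⟨e, rfl⟩
      · rw [Set.mem_singleton_iff.mp hz]
        change ψ₁ * ψ₂ ∈ _
        rw [hcc (ψ₁ * ψ₂)]
        exact Ideal.mul_mem_left _ _ hψm
      · change ψ₁ * pderiv e ψ₂ ∈ _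
        by_cases he : e ∈ s
        · rw [z₂ e he, mul_zero]; exact zero_mem _
        · have := hdm e
          rw [z₁ e he, mul_zero, zero_add] at this
          rw [hcc (ψ₁ * _)]
          exact Ideal.mul_mem_left _ _ this

lemma suppOn_zero {F : Finset E} {x : E → K} (hx : x ∈ suppOn (K := K) F) {e : E} (he : e ∉ F) :
    x e = 0 := congrFun (LinearMap.mem_ker.mp hx) ⟨e, he⟩

end Aux

/-- **Theorem (Decompositions of schemes).**
Let `W ⊆ K^E` realize a loopless matroid which decomposes as a direct sum along the
partition `E = E₁ ⊔ E₁ᶜ`, with induced decomposition `W = W₁ ⊕ W₂`,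
`Wᵢ = W ∩ K^{Eᵢ}`.  Then `J_W = ⟨ψ_{W₁}, ψ_{W₂}⟩ ∩ J_{W₁} ∩ J_{W₂}` and
`M_W = ⟨ψ_{W₁}, ψ_{W₂}⟩ ∩ M_{W₁} ∩ M_{W₂}` in `K[x_e : e ∈ E]`; moreover the
configuration hypersurface `X_W` is generically smooth over `K`: no minimal prime
over `⟨ψ_W⟩` contains `J_W`. -/
theorem jacIdeal_of_direct_sum_decomposition
    (W : Submodule K (E → K)) (E₁ : Finset E) {r r₁ r₂ : ℕ}
    (w : Fin r → E → K) (w₁ : Fin r₁ → E → K) (w₂ : Fin r₂ → E → K)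
    (hw : IsBasisOf w W)
    (hw₁ : IsBasisOf w₁ (W ⊓ suppOn E₁))
    (hw₂ : IsBasisOf w₂ (W ⊓ suppOn E₁ᶜ))
    (hloopless : ∀ e : E, Indep W {e})
    (hdec : W = (W ⊓ suppOn E₁) ⊔ (W ⊓ suppOn E₁ᶜ)) :
    jacIdeal w = Ideal.span {psi w₁, psi w₂} ⊓ jacIdeal w₁ ⊓ jacIdeal w₂ ∧
    minorIdeal w = Ideal.span {psi w₁, psi w₂} ⊓ minorIdeal w₁ ⊓ minorIdeal w₂ ∧
    (∀ p ∈ (Ideal.span {psi w}).minimalPrimes, ¬ jacIdeal w ≤ p) := by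
  have hs₁ : ∀ i, ∀ e ∉ (E₁ : Set E), w₁ i e = 0 := by
    intro i e he
    have hi : w₁ i ∈ W ⊓ suppOn E₁ := hw₁.2 ▸ Submodule.subset_span ⟨i, rfl⟩
    exact suppOn_zero hi.2 (by simpa using he)
  have hs₂ : ∀ i, ∀ e ∉ ((E₁ : Set E)ᶜ), w₂ i e = 0 := by
    intro i e he
    have hi : w₂ i ∈ W ⊓ suppOn E₁ᶜ := hw₂.2 ▸ Submodule.subset_span ⟨i, rfl⟩
    exact suppOn_zero hi.2 (by simpa using he)
  have hmul : ∀ i j e, w₁ i e * w₂ j e = 0 := by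
    intro i j e
    by_cases he : e ∈ (E₁ : Set E)
    · rw [hs₂ j e (by simpa using he), mul_zero]
    · rw [hs₁ i e he, zero_mul]
  have hdisj : Disjoint (Submodule.span K (Set.range w₁)) (Submodule.span K (Set.range w₂)) := by
    rw [hw₁.2, hw₂.2, Submodule.disjoint_def]
    intro x hx hy
    ext e
    by_cases he : e ∈ E₁
    · exact suppOn_zero hy.2 (by simpa using he)
    · exact suppOn_zero hx.2 he
  have hli : LinearIndependent K (Sum.elim w₁ w₂) := hw₁.1.sum_type hw₂.1 hdisj
  have hspan : Submodule.span K (Set.range w) =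
      Submodule.span K (Set.range (Sum.elim w₁ w₂)) := by
    rw [Set.Sum.elim_range, Submodule.span_union, hw.2, hw₁.2, hw₂.2]
    exact hdec
  have n₁ : psi w₁ ≠ 0 := det_QG_ne_zero hw₁.1
  have n₂ : psi w₂ ≠ 0 := det_QG_ne_zero hw₂.1
  have hq₁ := QG_supported hs₁
  have hq₂ := QG_supported hs₂
  have p₁ : psi w₁ ∈ MvPolynomial.supported K (E₁ : Set E) := det_supported hq₁
  have p₂ : psi w₂ ∈ MvPolynomial.supported K ((E₁ : Set E)ᶜ) := det_supported hq₂
  have hd : Disjoint (E₁ : Set E) ((E₁ : Set E)ᶜ) := disjoint_compl_right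
  refine ⟨?_, ?_, ?_⟩
  · obtain ⟨c, hc, hcψ⟩ := det_inv hw.1 hli hspan
    rw [QG_block hmul, Matrix.det_fromBlocks_zero₂₁] at hcψ
    have h1 : jacIdeal w = Ideal.span {psi w₂} * jacIdeal w₁ ⊔ Ideal.span {psi w₁} * jacIdeal w₂ :=
      jac_block hc hcψ p₁ p₂
    rw [h1]
    refine ideal_decomp (Ideal.subset_span (Or.inl rfl)) (Ideal.subset_span (Or.inl rfl)) ?_ ?_
    · intro x hx
      refine mem_of_mul_mem hd ?_ n₂ p₂ hx
      rintro _ (rfl | ⟨e, rfl⟩)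
      · exact p₁
      · exact pderiv_supported p₁ e
    · intro x hx
      refine mem_of_mul_mem hd.symm ?_ n₁ p₁ hx
      rintro _ (rfl | ⟨e, rfl⟩)
      · exact p₂
      · exact pderiv_supported p₂ e
  · rcases Nat.eq_zero_or_pos r₁ with rfl | hr₁
    · have hz : psi w₁ = 1 := Matrix.det_isEmpty
      have htop : Ideal.span {psi w₁, psi w₂} = ⊤ := by
        rw [Ideal.eq_top_iff_one, ← hz]
        exact Ideal.subset_span (Or.inl rfl)
      rw [htop, minorIdeal_zero w₁, top_inf_eq, top_inf_eq]
      refine minorIdeal_inv hw.1 hw₂.1 ?_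
      rw [hspan, Set.Sum.elim_range, Set.range_eq_empty w₁, Set.empty_union]
    rcases Nat.eq_zero_or_pos r₂ with rfl | hr₂
    · have hz : psi w₂ = 1 := Matrix.det_isEmpty
      have htop : Ideal.span {psi w₁, psi w₂} = ⊤ := by
        rw [Ideal.eq_top_iff_one, ← hz]
        exact Ideal.subset_span (Or.inr rfl)
      rw [htop, minorIdeal_zero w₂, top_inf_eq, inf_top_eq]
      refine minorIdeal_inv hw.1 hw₁.1 ?_
      rw [hspan, Set.Sum.elim_range, Set.range_eq_empty w₂, Set.union_empty]
    have hr : r ≠ 0 := by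
      obtain ⟨ε, _⟩ := basis_change hw.1 hli hspan
      have := Fintype.card_congr ε
      simp at this
      omega
    have h1 : adjI (QG w) = Ideal.span {psi w₂} * adjI (QG w₁) ⊔
        Ideal.span {psi w₁} * adjI (QG w₂) := by
      rw [adjI_inv hw.1 hli hspan, QG_block hmul]
      exact adjI_block _ _ n₁ n₂
    have e₁ := minorIdeal_eq hr₁.ne' w₁
    have e₂ := minorIdeal_eq hr₂.ne' w₂
    rw [minorIdeal_eq hr, h1, ← e₁, ← e₂]
    refine ideal_decomp (e₁ ▸ det_mem_adjI (QG w₁) ⟨0, hr₁⟩) (e₂ ▸ det_mem_adjI (QG w₂) ⟨0, hr₂⟩)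
      ?_ ?_
    · intro x hx
      refine mem_of_mul_mem hd ?_ n₂ p₂ hx
      rintro _ ⟨f, g, rfl⟩
      exact det_supported fun i j => hq₁ _ _
    · intro x hx
      refine mem_of_mul_mem hd.symm ?_ n₁ p₁ hx
      rintro _ ⟨f, g, rfl⟩
      exact det_supported fun i j => hq₂ _ _
  · intro p hp hle
    exact smooth_aux (det_QG_ne_zero hw.1) (det_QG_linear w) p hp hle

end Config
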